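/- arXiv:2110.00629 — 6 statements merged into one kernel-verified Lean document; each statement's English description precedes it below -/
import Mathlib

section
/- Assume the cost tensor C has nonnegative entries. For every ε > 0, MMOT-DC_ε((T_m)_{m=1}^M, μ) = 0 if and only if F-MMOT((T_m)_{m=1}^M, μ) = 0. -/
open scoped BigOperators

namespace MMOTPaper

variable {N M : ℕ}

/-- Frobenius inner product of two tensors. -/
def inner' {ι : Type*} [Fintype ι] (C P : ι → ℝ) : ℝ := ∑ x, C x * P x

/-- A probability tensor: nonnegative entries summing to 1. -/
def IsProb {ι : Type*} [Fintype ι] (P : ι → ℝ) : Prop :=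
  (∀ x, 0 ≤ P x) ∧ ∑ x, P x = 1

/-- Negative entropy `H(P) = ∑ P log P`. -/
noncomputable def negEnt {ι : Type*} [Fintype ι] (P : ι → ℝ) : ℝ :=
  ∑ x, P x * Real.log (P x)

/-- Kullback-Leibler divergence; `⊤` if `μ` is not absolutely continuous w.r.t. `ν`. -/
noncomputable def KL {ι : Type*} [Fintype ι] (μ ν : ι → ℝ) : EReal :=
  if ∀ x, ν x = 0 → μ x = 0 then ((∑ x, μ x * Real.log (μ x / ν x) : ℝ) : EReal)
  else ⊤

/-- `n`-th marginal vector of a tensor. -/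
def marg1 (a : Fin N → ℕ) (P : ((n : Fin N) → Fin (a n)) → ℝ) (n : Fin N)
    (i : Fin (a n)) : ℝ :=
  ∑ x : (n : Fin N) → Fin (a n), if x n = i then P x else 0

/-- The set `U_T` of admissible couplings: probability tensors with marginals `μ n`. -/
def UT (a : Fin N → ℕ) (μ : (n : Fin N) → Fin (a n) → ℝ) :
    Set (((n : Fin N) → Fin (a n)) → ℝ) :=
  {P | IsProb P ∧ ∀ n i, marg1 a P n i = μ n i}

/-- A tuple partition of `(1,…,N)` into `M` blocks, encoded by the block assignment map:
monotonicity says the blocks are tuples of consecutive indices concatenating to `T`,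
surjectivity says each block is nonempty. -/
def IsPartition (part : Fin N → Fin M) : Prop :=
  Monotone part ∧ Function.Surjective part

/-- Restriction of a full index to the coordinates of block `m`. -/
def restr (a : Fin N → ℕ) (part : Fin N → Fin M) (m : Fin M)
    (x : (n : Fin N) → Fin (a n)) : (n : {n : Fin N // part n = m}) → Fin (a n.1) :=
  fun n => x n.1

/-- The `T_m`-marginal tensor `P_{#m}` of `P`: sum over all dimensions not in block `m`. -/
def margBlock (a : Fin N → ℕ) (part : Fin N → Fin M) (m : Fin M)
    (P : ((n : Fin N) → Fin (a n)) → ℝ)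
    (y : (n : {n : Fin N // part n = m}) → Fin (a n.1)) : ℝ :=
  ∑ x : (n : Fin N) → Fin (a n), if restr a part m x = y then P x else 0

/-- Tensor product of block tensors. -/
def tprod (a : Fin N → ℕ) (part : Fin N → Fin M)
    (Q : (m : Fin M) → ((n : {n : Fin N // part n = m}) → Fin (a n.1)) → ℝ)
    (x : (n : Fin N) → Fin (a n)) : ℝ :=
  ∏ m, Q m (restr a part m x)

/-- `P_{#T}`: the tensor product of the block marginals of `P`. -/
def prodMarg (a : Fin N → ℕ) (part : Fin N → Fin M)
    (P : ((n : Fin N) → Fin (a n)) → ℝ) : ((n : Fin N) → Fin (a n)) → ℝ :=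
  tprod a part (fun m => margBlock a part m P)

/-- The product tensor `μ_1 ⊗ … ⊗ μ_N`. -/
def prodMu (a : Fin N → ℕ) (μ : (n : Fin N) → Fin (a n) → ℝ)
    (x : (n : Fin N) → Fin (a n)) : ℝ :=
  ∏ n, μ n (x n)

/-- The set `F_M` of admissible couplings factorizing as a tensor product
of probability tensors indexed by the blocks. -/
def FM (a : Fin N → ℕ) (μ : (n : Fin N) → Fin (a n) → ℝ) (part : Fin N → Fin M) :
    Set (((n : Fin N) → Fin (a n)) → ℝ) :=
  {P | P ∈ UT a μ ∧
    ∃ Q : (m : Fin M) → ((n : {n : Fin N // part n = m}) → Fin (a n.1)) → ℝ,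
      (∀ m, IsProb (Q m)) ∧ P = tprod a part Q}

/-- The MMOT value `inf_{P ∈ U_T} ⟨C, P⟩`. -/
noncomputable def MMOTval (a : Fin N → ℕ) (μ : (n : Fin N) → Fin (a n) → ℝ)
    (C : ((n : Fin N) → Fin (a n)) → ℝ) : ℝ :=
  sInf ((fun P => inner' C P) '' UT a μ)

/-- The F-MMOT value `inf_{P ∈ F_M} ⟨C, P⟩`. -/
noncomputable def FMMOTval (a : Fin N → ℕ) (μ : (n : Fin N) → Fin (a n) → ℝ)
    (part : Fin N → Fin M) (C : ((n : Fin N) → Fin (a n)) → ℝ) : ℝ :=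
  sInf ((fun P => inner' C P) '' FM a μ part)

/-- The MMOT-DC objective `⟨C, P⟩ + ε KL(P | P_{#T})`. -/
noncomputable def dcObj (a : Fin N → ℕ) (part : Fin N → Fin M)
    (C : ((n : Fin N) → Fin (a n)) → ℝ) (ε : ℝ)
    (P : ((n : Fin N) → Fin (a n)) → ℝ) : EReal :=
  ((inner' C P : ℝ) : EReal) + (ε : EReal) * KL P (prodMarg a part P)

/-- The MMOT-DC value `inf_{P ∈ U_T} ⟨C, P⟩ + ε KL(P | P_{#T})`. -/
noncomputable def MMOTDCval (a : Fin N → ℕ) (μ : (n : Fin N) → Fin (a n) → ℝ)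
    (part : Fin N → Fin M) (C : ((n : Fin N) → Fin (a n)) → ℝ) (ε : ℝ) : EReal :=
  ⨅ P ∈ UT a μ, dcObj a part C ε P

theorem aux_sum {ι : Type*} [Fintype ι] [DecidableEq ι] {α : ι → Type*} [∀ i, Fintype (α i)]
    (Q : (i : ι) → α i → ℝ) (hQ : ∀ i, ∑ z, Q i z = 1) (i₀ : ι) (g : α i₀ → ℝ) :
    ∑ x : (i : ι) → α i, g (x i₀) * ∏ i, Q i (x i) = ∑ z, g z * Q i₀ z := by
  classical
  have h1 : ∀ x : (i : ι) → α i, g (x i₀) * ∏ i, Q i (x i)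
      = ∏ i, (Function.update (fun i (_ : α i) => (1 : ℝ)) i₀ g i (x i) * Q i (x i)) := by
    intro x
    rw [Finset.prod_mul_distrib]
    congr 1
    rw [Finset.prod_eq_single i₀]
    · simp
    · intro b _ hb
      simp [Function.update_of_ne hb]
    · simp
  simp_rw [h1]
  rw [← Fintype.prod_sum (fun i z => Function.update (fun i (_ : α i) => (1 : ℝ)) i₀ g i z * Q i z)]
  rw [Finset.prod_eq_single i₀]
  · simp
  · intro b _ hb
    simp [Function.update_of_ne hb, hQ]
  · simp

/-- Full indices are families of block indices. -/
def blockEquiv {N M : ℕ} (a : Fin N → ℕ) (part : Fin N → Fin M) :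
    ((n : Fin N) → Fin (a n)) ≃
      ((m : Fin M) → (n : {n : Fin N // part n = m}) → Fin (a n.1)) where
  toFun x m := restr a part m x
  invFun y n := y (part n) ⟨n, rfl⟩
  left_inv x := rfl
  right_inv y := by
    funext m n
    obtain ⟨n, rfl⟩ := n
    rfl

theorem sum_tprod {N M : ℕ} (a : Fin N → ℕ) (part : Fin N → Fin M)
    (Q : (m : Fin M) → ((n : {n : Fin N // part n = m}) → Fin (a n.1)) → ℝ)
    (hQ : ∀ m, ∑ z, Q m z = 1) (m₀ : Fin M)
    (g : ((n : {n : Fin N // part n = m₀}) → Fin (a n.1)) → ℝ) :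
    ∑ x, g (restr a part m₀ x) * tprod a part Q x = ∑ z, g z * Q m₀ z := by
  rw [← aux_sum Q hQ m₀ g]
  exact Fintype.sum_equiv (blockEquiv a part) _ _ (fun x => rfl)

theorem sum_margBlock {N M : ℕ} (a : Fin N → ℕ) (part : Fin N → Fin M)
    (P : ((n : Fin N) → Fin (a n)) → ℝ) (m : Fin M)
    (g : ((n : {n : Fin N // part n = m}) → Fin (a n.1)) → ℝ) :
    ∑ z, g z * margBlock a part m P z = ∑ x, g (restr a part m x) * P x := by
  simp only [margBlock, Finset.mul_sum]
  rw [Finset.sum_comm]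
  refine Finset.sum_congr rfl fun x _ => ?_
  simp

theorem margBlock_isProb {N M : ℕ} (a : Fin N → ℕ) (part : Fin N → Fin M)
    (P : ((n : Fin N) → Fin (a n)) → ℝ) (hP : IsProb P) (m : Fin M) :
    IsProb (margBlock a part m P) := by
  refine ⟨fun y => Finset.sum_nonneg fun x _ => ?_, ?_⟩
  · split_ifs
    · exact hP.1 x
    · exact le_rfl
  · have := sum_margBlock a part P m (fun _ => 1)
    simpa [hP.2] using this

theorem margBlock_tprod {N M : ℕ} (a : Fin N → ℕ) (part : Fin N → Fin M)
    (Q : (m : Fin M) → ((n : {n : Fin N // part n = m}) → Fin (a n.1)) → ℝ)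
    (hQ : ∀ m, IsProb (Q m)) (m : Fin M) : margBlock a part m (tprod a part Q) = Q m := by
  funext y
  have := sum_tprod a part Q (fun m => (hQ m).2) m (fun z => if z = y then 1 else 0)
  simpa [margBlock] using this

theorem prodMarg_mem {N M : ℕ} (hM : 0 < M) (a : Fin N → ℕ)
    (μ : (n : Fin N) → Fin (a n) → ℝ) (part : Fin N → Fin M)
    (P : ((n : Fin N) → Fin (a n)) → ℝ) (hP : P ∈ UT a μ) :
    prodMarg a part P ∈ FM a μ part := by
  have hQ := margBlock_isProb a part P hP.1
  refine ⟨⟨⟨fun x => ?_, ?_⟩, ?_⟩, _, hQ, rfl⟩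
  · unfold prodMarg tprod
    exact Finset.prod_nonneg fun m _ => (hQ m).1 _
  · have := sum_tprod a part _ (fun m => (hQ m).2) ⟨0, hM⟩ (fun _ => 1)
    simp only [one_mul] at this
    exact this.trans (hQ _).2
  · intro n i
    rw [← hP.2 n i]
    have h1 := sum_tprod a part _ (fun m => (hQ m).2) (part n)
      (fun z => if z ⟨n, rfl⟩ = i then 1 else 0)
    rw [sum_margBlock] at h1
    simp only [ite_mul, one_mul, zero_mul] at h1
    exact h1

theorem prodMu_mem {N : ℕ} (hN : 0 < N) (a : Fin N → ℕ)
    (μ : (n : Fin N) → Fin (a n) → ℝ) (hμ : ∀ n, IsProb (μ n)) : prodMu a μ ∈ UT a μ := by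
  refine ⟨⟨fun x => Finset.prod_nonneg fun n _ => (hμ n).1 _, ?_⟩, ?_⟩
  · have := aux_sum μ (fun m => (hμ m).2) ⟨0, hN⟩ (fun _ => 1)
    simp only [one_mul] at this
    exact this.trans (hμ _).2
  · intro n i
    have := aux_sum μ (fun m => (hμ m).2) n (fun z => if z = i then 1 else 0)
    simpa [marg1, prodMu] using this

theorem abs_cont {N M : ℕ} (a : Fin N → ℕ) (part : Fin N → Fin M)
    (P : ((n : Fin N) → Fin (a n)) → ℝ) (hP : IsProb P) (x : (n : Fin N) → Fin (a n))
    (h : prodMarg a part P x = 0) : P x = 0 := by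
  unfold prodMarg tprod at h
  obtain ⟨m, -, hm⟩ := Finset.prod_eq_zero_iff.1 h
  unfold margBlock at hm
  have h0 := (Finset.sum_eq_zero_iff_of_nonneg (fun y _ => by
    split_ifs
    · exact hP.1 y
    · exact le_rfl)).1 hm x (Finset.mem_univ _)
  simpa using h0

theorem log_ineq (p r : ℝ) (hp : 0 ≤ p) (hr : 0 ≤ r) (h : r = 0 → p = 0) :
    (√p - √r) ^ 2 ≤ p * Real.log (p / r) - p + r := by
  rcases hp.eq_or_lt with rfl | hp
  · simp [Real.sq_sqrt hr]
  have hr : 0 < r := lt_of_le_of_ne hr fun h0 => hp.ne' (h h0.symm)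
  have hsp := Real.sqrt_pos.2 hp
  have hsr := Real.sqrt_pos.2 hr
  have h1 := Real.log_le_sub_one_of_pos (div_pos hsr hsp)
  rw [Real.log_div hsr.ne' hsp.ne', Real.log_sqrt hp.le, Real.log_sqrt hr.le] at h1
  rw [Real.log_div hp.ne' hr.ne']
  have h2 := mul_le_mul_of_nonneg_left h1 hp.le
  have h3 : p * (√r / √p - 1) = √p * √r - p := by
    rw [mul_sub, mul_one, mul_div_assoc']
    congr 1
    rw [div_eq_iff hsp.ne']
    nlinarith [Real.sq_sqrt hp.le]
  nlinarith [Real.sq_sqrt hp.le, Real.sq_sqrt hr.le]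

theorem kl_bound {ι : Type*} [Fintype ι] (P R C : ι → ℝ) (hP : IsProb P) (hR : IsProb R)
    (hC : ∀ x, 0 ≤ C x) (h : ∀ x, R x = 0 → P x = 0) :
    0 ≤ ∑ x, P x * Real.log (P x / R x) ∧
    inner' C R ≤ 2 * inner' C P + 2 * (∑ x, C x) * ∑ x, P x * Real.log (P x / R x) := by
  have hs : ∑ x, (√(P x) - √(R x)) ^ 2 ≤ ∑ x, P x * Real.log (P x / R x) := by
    refine (Finset.sum_le_sum fun x _ => log_ineq _ _ (hP.1 x) (hR.1 x) (h x)).trans_eq ?_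
    rw [Finset.sum_add_distrib, Finset.sum_sub_distrib, hP.2, hR.2]
    ring
  refine ⟨(Finset.sum_nonneg fun x _ => sq_nonneg _).trans hs, ?_⟩
  unfold inner'
  set K := ∑ x, P x * Real.log (P x / R x)
  rw [Finset.mul_sum, mul_assoc, Finset.sum_mul, Finset.mul_sum, ← Finset.sum_add_distrib]
  refine Finset.sum_le_sum fun x _ => ?_
  have h1 : (√(P x) - √(R x)) ^ 2 ≤ K :=
    (Finset.single_le_sum (f := fun x => (√(P x) - √(R x)) ^ 2)
      (fun y _ => sq_nonneg _) (Finset.mem_univ x)).trans hs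
  have h2 : R x ≤ 2 * P x + 2 * K := by
    nlinarith [Real.sq_sqrt (hP.1 x), Real.sq_sqrt (hR.1 x), sq_nonneg (2 * √(P x) - √(R x))]
  nlinarith [mul_le_mul_of_nonneg_left h2 (hC x)]

theorem dcObj_eq {N M : ℕ} (a : Fin N → ℕ) (part : Fin N → Fin M)
    (C : ((n : Fin N) → Fin (a n)) → ℝ) (ε : ℝ)
    (P : ((n : Fin N) → Fin (a n)) → ℝ) (hP : IsProb P) :
    dcObj a part C ε P = ((inner' C P + ε * ∑ x, P x * Real.log (P x / prodMarg a part P x) : ℝ)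
      : EReal) := by
  rw [dcObj, KL, if_pos (abs_cont a part P hP)]
  push_cast
  rfl

theorem inner'_nonneg {ι : Type*} [Fintype ι] (C P : ι → ℝ) (hC : ∀ x, 0 ≤ C x)
    (hP : ∀ x, 0 ≤ P x) : 0 ≤ inner' C P :=
  Finset.sum_nonneg fun x _ => mul_nonneg (hC x) (hP x)

/-- If `C` has nonnegative entries then, for every `ε > 0`,
`MMOT-DC_ε((T_m), μ) = 0` iff `F-MMOT((T_m), μ) = 0`. -/
theorem mmotdc_eq_zero_iff_fmmot_eq_zero {N M : ℕ} (hN : 0 < N) (hM : 0 < M)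
    (a : Fin N → ℕ) (ha : ∀ n, 0 < a n)
    (μ : (n : Fin N) → Fin (a n) → ℝ) (hμ : ∀ n, IsProb (μ n))
    (part : Fin N → Fin M) (hpart : IsPartition part)
    (C : ((n : Fin N) → Fin (a n)) → ℝ) (hC : ∀ x, 0 ≤ C x) :
    ∀ ε : ℝ, 0 < ε →
      (MMOTDCval a μ part C ε = (0 : EReal) ↔ FMMOTval a μ part C = 0) := by
  intro ε hε
  have hbdd : ∀ v ∈ (fun P => inner' C P) '' FM a μ part, 0 ≤ v := by
    rintro _ ⟨P, hP, rfl⟩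
    exact inner'_nonneg C P hC hP.1.1.1
  have hne : ((fun P => inner' C P) '' FM a μ part).Nonempty :=
    ⟨_, _, prodMarg_mem hM a μ part _ (prodMu_mem hN a μ hμ), rfl⟩
  have key : ∀ P ∈ UT a μ, 0 ≤ ∑ x, P x * Real.log (P x / prodMarg a part P x) ∧
      inner' C (prodMarg a part P) ≤ 2 * inner' C P
        + 2 * (∑ x, C x) * ∑ x, P x * Real.log (P x / prodMarg a part P x) := fun P hP =>
    kl_bound P _ C hP.1 (prodMarg_mem hM a μ part P hP).1.1 hC (abs_cont a part P hP.1)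
  constructor
  · intro h
    refine le_antisymm ?_ (Real.sInf_nonneg hbdd)
    by_contra hF
    push Not at hF
    have hS : 0 ≤ ∑ x, C x := Finset.sum_nonneg fun x _ => hC x
    set L : ℝ := 2 + 2 * (∑ x, C x) / ε with hL
    have hLpos : 0 < L := by positivity
    have hle : ((FMMOTval a μ part C / L : ℝ) : EReal) ≤ MMOTDCval a μ part C ε := by
      refine le_iInf₂ fun P hP => ?_
      rw [dcObj_eq a part C ε P hP.1]
      refine EReal.coe_le_coe_iff.2 ?_
      rw [div_le_iff₀ hLpos]
      obtain ⟨hk, hb⟩ := key P hP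
      have h1 : FMMOTval a μ part C ≤ inner' C (prodMarg a part P) :=
        csInf_le ⟨0, hbdd⟩ ⟨_, prodMarg_mem hM a μ part P hP, rfl⟩
      refine h1.trans (hb.trans ?_)
      have h0 := inner'_nonneg C P hC hP.1.1
      set K := ∑ x, P x * Real.log (P x / prodMarg a part P x)
      have e : (inner' C P + ε * K) * L = 2 * inner' C P + 2 * (∑ x, C x) * K
          + (2 * ε * K + inner' C P * (2 * (∑ x, C x) / ε)) := by
        rw [hL]
        field_simp
        ring
      rw [e]
      have : 0 ≤ 2 * ε * K + inner' C P * (2 * (∑ x, C x) / ε) := by positivity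
      linarith
    rw [h] at hle
    have h2 : FMMOTval a μ part C / L ≤ 0 := by exact_mod_cast hle
    exact absurd h2 (not_le.2 (div_pos hF hLpos))
  · intro h
    refine le_antisymm ?_ ?_
    · by_contra hlt
      push Not at hlt
      obtain ⟨δ, hδ, hδ'⟩ := EReal.lt_iff_exists_real_btwn.1 hlt
      have hδ0 : (0 : ℝ) < δ := by exact_mod_cast hδ
      rw [← h] at hδ0
      obtain ⟨_, ⟨P, hP, rfl⟩, hPδ⟩ := exists_lt_of_csInf_lt hne hδ0
      have h1 : MMOTDCval a μ part C ε ≤ dcObj a part C ε P := iInf₂_le P hP.1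
      have h2 : prodMarg a part P = P := by
        obtain ⟨-, Q, hQ, rfl⟩ := hP
        unfold prodMarg
        congr 1
        funext m
        exact margBlock_tprod a part Q hQ m
      rw [dcObj_eq a part C ε P hP.1.1, h2] at h1
      have h3 : ∑ x, P x * Real.log (P x / P x) = 0 := by
        refine Finset.sum_eq_zero fun x _ => ?_
        by_cases hx : P x = 0
        · simp [hx]
        · simp [div_self hx]
      rw [h3, mul_zero, add_zero] at h1
      have h4 : (δ : EReal) < (inner' C P : ℝ) := hδ'.trans_le h1
      exact absurd (EReal.coe_lt_coe_iff.1 h4) (not_lt.2 hPδ.le)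
    · refine le_iInf₂ fun P hP => ?_
      rw [dcObj_eq a part C ε P hP.1]
      have h0 := inner'_nonneg C P hC hP.1.1
      have h1 := (key P hP).1
      exact_mod_cast add_nonneg h0 (mul_nonneg hε.le h1)

end MMOTPaper
end

section
/- Let (ε_k)_k be a sequence of positive reals with ε_k → 0, for each k let P_{ε_k} be a minimizer of MMOT-DC_{ε_k}((T_m)_{m=1}^M, μ), and suppose P_{ε_k} converges to some tensor P̃. Then for every minimizer P* of MMOT(μ), one has KL(P̃ | P̃_{#T}) ≤ KL(P* | P*_{#T}) (the cluster point P̃ has minimal mutual information among minimizers of MMOT). -/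
open scoped BigOperators

namespace MMOTPaper

variable {N M : ℕ}

lemma margBlock_ge (a : Fin N → ℕ) (part : Fin N → Fin M) (m : Fin M)
    (P : ((n : Fin N) → Fin (a n)) → ℝ) (hP : ∀ x, 0 ≤ P x) (x : (n : Fin N) → Fin (a n)) :
    P x ≤ margBlock a part m P (restr a part m x) := by
  unfold margBlock
  have h := Finset.single_le_sum
    (f := fun z => if restr a part m z = restr a part m x then P z else 0)
    (s := Finset.univ) (fun z _ => by split_ifs <;> simp [hP]) (Finset.mem_univ x)
  simpa using h

/-- Continuous expression for the mutual information. -/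
noncomputable def mutInf (a : Fin N → ℕ) (part : Fin N → Fin M)
    (P : ((n : Fin N) → Fin (a n)) → ℝ) : ℝ :=
  negEnt P - ∑ m, negEnt (margBlock a part m P)

lemma continuous_mutInf (a : Fin N → ℕ) (part : Fin N → Fin M) :
    Continuous (mutInf a part) := by
  unfold mutInf negEnt
  refine Continuous.sub ?_ ?_
  · exact continuous_finsetSum _ fun x _ => Real.continuous_mul_log.comp (continuous_apply x)
  · refine continuous_finsetSum _ fun m _ => continuous_finsetSum _ fun y _ => ?_
    refine Real.continuous_mul_log.comp ?_
    unfold margBlock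
    refine continuous_finsetSum _ fun x _ => ?_
    split_ifs
    · exact continuous_apply x
    · exact continuous_const

lemma sum_log_marg (a : Fin N → ℕ) (part : Fin N → Fin M) (m : Fin M)
    (P : ((n : Fin N) → Fin (a n)) → ℝ) :
    ∑ x, P x * Real.log (margBlock a part m P (restr a part m x))
      = negEnt (margBlock a part m P) := by
  have h : ∀ y, margBlock a part m P y * Real.log (margBlock a part m P y)
      = ∑ x, if restr a part m x = y then P x * Real.log (margBlock a part m P y) else 0 := by
    intro y
    generalize Real.log (margBlock a part m P y) = L
    rw [margBlock, Finset.sum_mul]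
    refine Finset.sum_congr rfl fun x _ => ?_
    split_ifs <;> simp
  unfold negEnt
  simp_rw [h]
  rw [Finset.sum_comm]
  simp

lemma KL_eq_mutInf (a : Fin N → ℕ) (part : Fin N → Fin M)
    (P : ((n : Fin N) → Fin (a n)) → ℝ) (hP : ∀ x, 0 ≤ P x) :
    KL P (prodMarg a part P) = ((mutInf a part P : ℝ) : EReal) := by
  have hac : ∀ x, prodMarg a part P x = 0 → P x = 0 := by
    intro x hx
    unfold prodMarg tprod at hx
    obtain ⟨m, _, hm⟩ := Finset.prod_eq_zero_iff.mp hx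
    have := margBlock_ge a part m P hP x
    linarith [hP x]
  unfold KL
  rw [if_pos hac]
  congr 1
  unfold mutInf
  simp_rw [← sum_log_marg a part]
  rw [Finset.sum_comm, negEnt, ← Finset.sum_sub_distrib]
  refine Finset.sum_congr rfl fun x _ => ?_
  by_cases hx : P x = 0
  · simp [hx]
  · have hpos : 0 < P x := lt_of_le_of_ne (hP x) (Ne.symm hx)
    have h1 : prodMarg a part P x ≠ 0 := fun h => hx (hac x h)
    rw [Real.log_div hx h1, mul_sub, ← Finset.mul_sum]
    congr 2
    unfold prodMarg tprod
    exact Real.log_prod fun m _ => ne_of_gt (hpos.trans_le (margBlock_ge a part m P hP x))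

/-- With `ε_k > 0`, `ε_k → 0`, minimizers `P k → P̃`, the cluster
point `P̃` has minimal mutual information: for every minimizer `P*` of `MMOT(μ)`,
`KL(P̃ | P̃_{#T}) ≤ KL(P* | P*_{#T})`. -/
theorem cluster_point_minimal_mutual_information {N M : ℕ} (hN : 0 < N) (hM : 0 < M)
    (a : Fin N → ℕ) (ha : ∀ n, 0 < a n)
    (μ : (n : Fin N) → Fin (a n) → ℝ) (hμ : ∀ n, IsProb (μ n))
    (part : Fin N → Fin M) (hpart : IsPartition part)
    (C : ((n : Fin N) → Fin (a n)) → ℝ)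
    (ε : ℕ → ℝ) (hεpos : ∀ k, 0 < ε k)
    (hε : Filter.Tendsto ε Filter.atTop (nhds 0))
    (P : ℕ → ((n : Fin N) → Fin (a n)) → ℝ)
    (hPmem : ∀ k, P k ∈ UT a μ)
    (hPmin : ∀ k, ∀ Q ∈ UT a μ, dcObj a part C (ε k) (P k) ≤ dcObj a part C (ε k) Q)
    (Pt : ((n : Fin N) → Fin (a n)) → ℝ)
    (hlim : Filter.Tendsto P Filter.atTop (nhds Pt)) :
    ∀ Pstar : ((n : Fin N) → Fin (a n)) → ℝ, Pstar ∈ UT a μ →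
      (∀ Q ∈ UT a μ, inner' C Pstar ≤ inner' C Q) →
      KL Pt (prodMarg a part Pt) ≤ KL Pstar (prodMarg a part Pstar) := by
  intro Pstar hS hmin
  have hnn : ∀ x, 0 ≤ Pt x := fun x =>
    ge_of_tendsto' ((tendsto_pi_nhds.mp hlim) x) fun k => (hPmem k).1.1 x
  rw [KL_eq_mutInf a part Pt hnn, KL_eq_mutInf a part Pstar hS.1.1, EReal.coe_le_coe_iff]
  refine le_of_tendsto' (((continuous_mutInf a part).tendsto Pt).comp hlim) fun k => ?_
  have h := hPmin k Pstar hS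
  unfold dcObj at h
  rw [KL_eq_mutInf a part _ (hPmem k).1.1, KL_eq_mutInf a part Pstar hS.1.1] at h
  have h' : inner' C (P k) + ε k * mutInf a part (P k)
      ≤ inner' C Pstar + ε k * mutInf a part Pstar := by exact_mod_cast h
  have h2 := hmin (P k) (hPmem k)
  change mutInf a part (P k) ≤ _
  exact le_of_mul_le_mul_left (by linarith) (hεpos k)

end MMOTPaper
end

section
/- Let N = 4 with T_1 = (1,2), T_2 = (3,4), a_1 = a_3 = m, a_2 = a_4 = n, μ_1 = μ_3 and μ_2 = μ_4. Fix ε > 0 and for probability matrices α, β ∈ ℝ^{m×n} define OT_ε(α, β) = inf { ⟨C,Q⟩ + ε H(Q) : Q a 4-D probability tensor with Q_{#1} = α and Q_{#2} = β }. Then every minimizer P_ε of MMOT-DC_ε((T_1,T_2), μ) satisfies the Sinkhorn-divergence inequality OT_ε((P_ε)_{#1}, (P_ε)_{#2}) ≤ ½ [ OT_ε((P_ε)_{#1}, (P_ε)_{#1}) + OT_ε((P_ε)_{#2}, (P_ε)_{#2}) ]. -/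
open scoped BigOperators

namespace MMOT4

variable {m n : ℕ}

/-- Frobenius inner product of 4-D tensors. -/
def inner4 (C P : Fin m → Fin n → Fin m → Fin n → ℝ) : ℝ :=
  ∑ i, ∑ j, ∑ k, ∑ l, C i j k l * P i j k l

/-- A 4-D probability tensor. -/
def IsProb4 (P : Fin m → Fin n → Fin m → Fin n → ℝ) : Prop :=
  (∀ i j k l, 0 ≤ P i j k l) ∧ ∑ i, ∑ j, ∑ k, ∑ l, P i j k l = 1

/-- `T_1 = (1,2)`-marginal matrix: sum over dimensions 3,4. -/
def marg12 (P : Fin m → Fin n → Fin m → Fin n → ℝ) (i : Fin m) (j : Fin n) : ℝ :=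
  ∑ k, ∑ l, P i j k l

/-- `T_2 = (3,4)`-marginal matrix: sum over dimensions 1,2. -/
def marg34 (P : Fin m → Fin n → Fin m → Fin n → ℝ) (k : Fin m) (l : Fin n) : ℝ :=
  ∑ i, ∑ j, P i j k l

/-- Single-coordinate marginals. -/
def marg1 (P : Fin m → Fin n → Fin m → Fin n → ℝ) (i : Fin m) : ℝ :=
  ∑ j, ∑ k, ∑ l, P i j k l

def marg2 (P : Fin m → Fin n → Fin m → Fin n → ℝ) (j : Fin n) : ℝ :=
  ∑ i, ∑ k, ∑ l, P i j k l

def marg3 (P : Fin m → Fin n → Fin m → Fin n → ℝ) (k : Fin m) : ℝ :=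
  ∑ i, ∑ j, ∑ l, P i j k l

def marg4 (P : Fin m → Fin n → Fin m → Fin n → ℝ) (l : Fin n) : ℝ :=
  ∑ i, ∑ j, ∑ k, P i j k l

/-- The admissible set `U_T` for the four prescribed marginals. -/
def UT4 (μ1 : Fin m → ℝ) (μ2 : Fin n → ℝ) (μ3 : Fin m → ℝ) (μ4 : Fin n → ℝ) :
    Set (Fin m → Fin n → Fin m → Fin n → ℝ) :=
  {P | IsProb4 P ∧ marg1 P = μ1 ∧ marg2 P = μ2 ∧ marg3 P = μ3 ∧ marg4 P = μ4}

/-- Kullback-Leibler divergence between 4-D probability tensors,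
`⊤` in the absence of absolute continuity. -/
noncomputable def KL4 (P Q : Fin m → Fin n → Fin m → Fin n → ℝ) : EReal :=
  if ∀ i j k l, Q i j k l = 0 → P i j k l = 0 then
    ((∑ i, ∑ j, ∑ k, ∑ l, P i j k l * Real.log (P i j k l / Q i j k l) : ℝ) : EReal)
  else ⊤

/-- `P_{#T} = P_{#1} ⊗ P_{#2}`. -/
def prodMarg4 (P : Fin m → Fin n → Fin m → Fin n → ℝ) :
    Fin m → Fin n → Fin m → Fin n → ℝ :=
  fun i j k l => marg12 P i j * marg34 P k l

/-- The MMOT-DC objective `⟨C, P⟩ + ε KL(P | P_{#T})`. -/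
noncomputable def dcObj4 (C : Fin m → Fin n → Fin m → Fin n → ℝ) (ε : ℝ)
    (P : Fin m → Fin n → Fin m → Fin n → ℝ) : EReal :=
  ((inner4 C P : ℝ) : EReal) + (ε : EReal) * KL4 P (prodMarg4 P)

/-- Negative entropy of a 4-D tensor. -/
noncomputable def negEnt4 (P : Fin m → Fin n → Fin m → Fin n → ℝ) : ℝ :=
  ∑ i, ∑ j, ∑ k, ∑ l, P i j k l * Real.log (P i j k l)

/-- Entropic OT value `OT_ε(α, β)` between two probability matrices, where the
couplings are 4-D probability tensors with `(1,2)`-marginal `α` and `(3,4)`-marginal `β`. -/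
noncomputable def OTeps (C : Fin m → Fin n → Fin m → Fin n → ℝ) (ε : ℝ)
    (α β : Fin m → Fin n → ℝ) : ℝ :=
  sInf ((fun Q => inner4 C Q + ε * negEnt4 Q) ''
    {Q | IsProb4 Q ∧ marg12 Q = α ∧ marg34 Q = β})

/-- Negative entropy of a matrix. -/
noncomputable def negEnt2 (a : Fin m → Fin n → ℝ) : ℝ :=
  ∑ i, ∑ j, a i j * Real.log (a i j)

lemma sum4_swap (f : Fin m → Fin n → Fin m → Fin n → ℝ) :
    ∑ i, ∑ j, ∑ k, ∑ l, f i j k l = ∑ k, ∑ l, ∑ i, ∑ j, f i j k l := by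
  have h1 : ∑ i, ∑ j, ∑ k, ∑ l, f i j k l
      = ∑ x : Fin m × Fin n, ∑ y : Fin m × Fin n, f x.1 x.2 y.1 y.2 := by
    simp only [Fintype.sum_prod_type]
  have h2 : ∑ k, ∑ l, ∑ i, ∑ j, f i j k l
      = ∑ y : Fin m × Fin n, ∑ x : Fin m × Fin n, f x.1 x.2 y.1 y.2 := by
    simp only [Fintype.sum_prod_type]
  rw [h1, h2, Finset.sum_comm]

lemma marg3_eq (Q : Fin m → Fin n → Fin m → Fin n → ℝ) (k : Fin m) :
    marg3 Q k = ∑ l, marg34 Q k l := by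
  unfold marg3 marg34
  rw [Finset.sum_comm]
  conv_rhs => rw [Finset.sum_comm]
  rw [Finset.sum_comm]
  exact Finset.sum_congr rfl fun i _ => Finset.sum_comm

lemma marg4_eq (Q : Fin m → Fin n → Fin m → Fin n → ℝ) (l : Fin n) :
    marg4 Q l = ∑ k, marg34 Q k l := by
  unfold marg4 marg34
  conv_rhs => rw [Finset.sum_comm]
  exact Finset.sum_congr rfl fun i _ => Finset.sum_comm

lemma zero_of_marg {Q : Fin m → Fin n → Fin m → Fin n → ℝ} (hQ : ∀ i j k l, 0 ≤ Q i j k l)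
    (i : Fin m) (j : Fin n) (k : Fin m) (l : Fin n) :
    Q i j k l ≤ marg12 Q i j ∧ Q i j k l ≤ marg34 Q k l := by
  constructor
  · calc Q i j k l ≤ ∑ l, Q i j k l :=
          Finset.single_le_sum (f := fun l => Q i j k l) (fun l _ => hQ i j k l) (Finset.mem_univ l)
      _ ≤ _ := Finset.single_le_sum (f := fun k => ∑ l, Q i j k l)
          (fun k _ => Finset.sum_nonneg fun l _ => hQ i j k l) (Finset.mem_univ k)
  · calc Q i j k l ≤ ∑ j, Q i j k l :=
          Finset.single_le_sum (f := fun j => Q i j k l) (fun j _ => hQ i j k l) (Finset.mem_univ j)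
      _ ≤ _ := Finset.single_le_sum (f := fun i => ∑ j, Q i j k l)
          (fun i _ => Finset.sum_nonneg fun j _ => hQ i j k l) (Finset.mem_univ i)

lemma dcObj4_eq (C : Fin m → Fin n → Fin m → Fin n → ℝ) (ε : ℝ)
    {Q : Fin m → Fin n → Fin m → Fin n → ℝ} (hQ : IsProb4 Q) :
    dcObj4 C ε Q = ((inner4 C Q + ε * negEnt4 Q
      - ε * (negEnt2 (marg12 Q) + negEnt2 (marg34 Q)) : ℝ) : EReal) := by
  have hz : ∀ i j k l, prodMarg4 Q i j k l = 0 → Q i j k l = 0 := by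
    intro i j k l h
    obtain ⟨h1, h2⟩ := zero_of_marg hQ.1 i j k l
    have h0 := hQ.1 i j k l
    rcases mul_eq_zero.1 h with h | h <;> linarith
  have h12 : ∑ i, ∑ j, ∑ k, ∑ l, Q i j k l * Real.log (marg12 Q i j)
      = negEnt2 (marg12 Q) := by
    unfold negEnt2
    refine Finset.sum_congr rfl fun i _ => Finset.sum_congr rfl fun j _ => ?_
    conv_rhs => rw [show marg12 Q i j * Real.log (marg12 Q i j)
      = (∑ k, ∑ l, Q i j k l) * Real.log (marg12 Q i j) from rfl]
    simp only [Finset.sum_mul]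
  have h34 : ∑ i, ∑ j, ∑ k, ∑ l, Q i j k l * Real.log (marg34 Q k l)
      = negEnt2 (marg34 Q) := by
    rw [sum4_swap]
    unfold negEnt2
    refine Finset.sum_congr rfl fun k _ => Finset.sum_congr rfl fun l _ => ?_
    conv_rhs => rw [show marg34 Q k l * Real.log (marg34 Q k l)
      = (∑ i, ∑ j, Q i j k l) * Real.log (marg34 Q k l) from rfl]
    simp only [Finset.sum_mul]
  have hkl : ∑ i, ∑ j, ∑ k, ∑ l, Q i j k l * Real.log (Q i j k l / prodMarg4 Q i j k l)
      = negEnt4 Q - negEnt2 (marg12 Q) - negEnt2 (marg34 Q) := by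
    rw [← h12, ← h34]
    unfold negEnt4
    simp only [← Finset.sum_sub_distrib]
    refine Finset.sum_congr rfl fun i _ => Finset.sum_congr rfl fun j _ =>
      Finset.sum_congr rfl fun k _ => Finset.sum_congr rfl fun l _ => ?_
    by_cases h : Q i j k l = 0
    · simp [h]
    · have hp : prodMarg4 Q i j k l ≠ 0 := fun h' => h (hz i j k l h')
      have hp' : marg12 Q i j * marg34 Q k l ≠ 0 := hp
      rw [Real.log_div h hp]
      unfold prodMarg4
      rw [Real.log_mul (left_ne_zero_of_mul hp') (right_ne_zero_of_mul hp')]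
      ring
  unfold dcObj4 KL4
  rw [if_pos hz, hkl, ← EReal.coe_mul, ← EReal.coe_add]
  congr 1
  ring

lemma exists_coupling {a b : Fin m → Fin n → ℝ} (ha : ∀ i j, 0 ≤ a i j) (hb : ∀ i j, 0 ≤ b i j)
    (ha1 : ∑ i, ∑ j, a i j = 1) (hb1 : ∑ i, ∑ j, b i j = 1) :
    ∃ Q, IsProb4 Q ∧ marg12 Q = a ∧ marg34 Q = b := by
  have h12 : marg12 (fun i j k l => a i j * b k l) = a := by
    funext i j
    simp only [marg12, ← Finset.mul_sum, hb1, mul_one]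
  refine ⟨fun i j k l => a i j * b k l,
    ⟨fun i j k l => mul_nonneg (ha i j) (hb k l), ?_⟩, h12, ?_⟩
  · simp only [← Finset.mul_sum, hb1, mul_one, ha1]
  · funext k l
    simp only [marg34, ← Finset.sum_mul, ha1, one_mul]

/-- In the 4-D setting with `T_1 = (1,2)`, `T_2 = (3,4)`, `μ_1 = μ_3`,
`μ_2 = μ_4` and `ε > 0`, every minimizer `P_ε` of `MMOT-DC_ε` satisfies the
Sinkhorn-divergence inequality
`OT_ε((P_ε)_{#1}, (P_ε)_{#2}) ≤ ½ [OT_ε((P_ε)_{#1},(P_ε)_{#1}) + OT_ε((P_ε)_{#2},(P_ε)_{#2})]`. -/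
theorem sinkhorn_divergence_nonpos {m n : ℕ} (hm : 0 < m) (hn : 0 < n)
    (μ1 μ3 : Fin m → ℝ) (μ2 μ4 : Fin n → ℝ)
    (hμ1 : (∀ i, 0 ≤ μ1 i) ∧ ∑ i, μ1 i = 1)
    (hμ2 : (∀ j, 0 ≤ μ2 j) ∧ ∑ j, μ2 j = 1)
    (hμ3 : (∀ i, 0 ≤ μ3 i) ∧ ∑ i, μ3 i = 1)
    (hμ4 : (∀ j, 0 ≤ μ4 j) ∧ ∑ j, μ4 j = 1)
    (h13 : μ1 = μ3) (h24 : μ2 = μ4)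
    (C : Fin m → Fin n → Fin m → Fin n → ℝ)
    (ε : ℝ) (hε : 0 < ε)
    (P : Fin m → Fin n → Fin m → Fin n → ℝ)
    (hPmem : P ∈ UT4 μ1 μ2 μ3 μ4)
    (hPmin : ∀ Q ∈ UT4 μ1 μ2 μ3 μ4, dcObj4 C ε P ≤ dcObj4 C ε Q) :
    OTeps C ε (marg12 P) (marg34 P) ≤
      (OTeps C ε (marg12 P) (marg12 P) + OTeps C ε (marg34 P) (marg34 P)) / 2 := by
  subst h13 h24
  obtain ⟨hP, hP1, hP2, hP3, hP4⟩ := hPmem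
  have a1 : ∀ i, ∑ j, marg12 P i j = μ1 i := fun i => congrFun hP1 i
  have a2 : ∀ j, ∑ i, marg12 P i j = μ2 j := fun j => congrFun hP2 j
  have b1 : ∀ i, ∑ j, marg34 P i j = μ1 i := fun i => by rw [← marg3_eq, hP3]
  have b2 : ∀ j, ∑ i, marg34 P i j = μ2 j := fun j => by rw [← marg4_eq, hP4]
  have mem : ∀ a b : Fin m → Fin n → ℝ, (∀ i, ∑ j, a i j = μ1 i) → (∀ j, ∑ i, a i j = μ2 j) →
      (∀ i, ∑ j, b i j = μ1 i) → (∀ j, ∑ i, b i j = μ2 j) →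
      ∀ Q, IsProb4 Q → marg12 Q = a → marg34 Q = b →
      inner4 C P + ε * negEnt4 P - ε * (negEnt2 (marg12 P) + negEnt2 (marg34 P)) ≤
      inner4 C Q + ε * negEnt4 Q - ε * (negEnt2 a + negEnt2 b) := by
    intro a b ha1 ha2 hb1 hb2 Q hQ hQa hQb
    have := hPmin Q ⟨hQ, ?_, ?_, ?_, ?_⟩
    · rw [dcObj4_eq C ε hP, dcObj4_eq C ε hQ, EReal.coe_le_coe_iff, hQa, hQb] at this
      exact this
    · funext i
      rw [← ha1 i, ← hQa]; rfl
    · funext j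
      rw [← ha2 j, ← hQa]; rfl
    · funext k
      rw [marg3_eq, hQb, hb1]
    · funext l
      rw [marg4_eq, hQb, hb2]
  have hle : OTeps C ε (marg12 P) (marg34 P) ≤ inner4 C P + ε * negEnt4 P := by
    refine csInf_le ⟨inner4 C P + ε * negEnt4 P, ?_⟩ ⟨P, ⟨hP, rfl, rfl⟩, rfl⟩
    rintro _ ⟨Q, ⟨hQ, hQa, hQb⟩, rfl⟩
    have := mem _ _ a1 a2 b1 b2 Q hQ hQa hQb
    simp only
    linarith
  have na : ∀ i j, 0 ≤ marg12 P i j := fun i j =>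
    Finset.sum_nonneg fun k _ => Finset.sum_nonneg fun l _ => hP.1 i j k l
  have nb : ∀ i j, 0 ≤ marg34 P i j := fun k l =>
    Finset.sum_nonneg fun i _ => Finset.sum_nonneg fun j _ => hP.1 i j k l
  have sa : ∑ i, ∑ j, marg12 P i j = 1 := by simp only [a1, hμ1.2]
  have sb : ∑ i, ∑ j, marg34 P i j = 1 := by simp only [b1, hμ1.2]
  have haa : inner4 C P + ε * negEnt4 P + ε * (negEnt2 (marg12 P) - negEnt2 (marg34 P))
      ≤ OTeps C ε (marg12 P) (marg12 P) := by
    obtain ⟨R, hR⟩ := exists_coupling na na sa sa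
    refine le_csInf ⟨_, R, hR, rfl⟩ ?_
    rintro _ ⟨Q, ⟨hQ, hQa, hQb⟩, rfl⟩
    have := mem _ _ a1 a2 a1 a2 Q hQ hQa hQb
    simp only
    linarith
  have hbb : inner4 C P + ε * negEnt4 P + ε * (negEnt2 (marg34 P) - negEnt2 (marg12 P))
      ≤ OTeps C ε (marg34 P) (marg34 P) := by
    obtain ⟨R, hR⟩ := exists_coupling nb nb sb sb
    refine le_csInf ⟨_, R, hR, rfl⟩ ?_
    rintro _ ⟨Q, ⟨hQ, hQa, hQb⟩, rfl⟩
    have := mem _ _ b1 b2 b1 b2 Q hQ hQa hQb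
    simp only
    linarith
  linarith

end MMOT4
end

section
/- Let N = 4 with T_1 = (1,2), T_2 = (3,4), a_1 = a_3 = m, a_2 = a_4 = n, μ_1 = μ_3 and μ_2 = μ_4. Assume the cost tensor C is symmetric in the sense C_{i,j,k,l} = C_{k,l,i,j}, and that for the given ε > 0 the (mn)×(mn) matrix K with entries K_{(i,j),(k,l)} = exp(−C_{i,j,k,l}/ε) is a (symmetric) positive definite matrix. Then every minimizer P_ε of MMOT-DC_ε((T_1,T_2), μ) satisfies (P_ε)_{#1} = (P_ε)_{#2}. -/
open scoped BigOperators

namespace MMOT4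

variable {m n : ℕ}

section Abstract
variable {ι : Type*} [Fintype ι]

lemma aux_scaling [DecidableEq ι] (K : ι → ι → ℝ) (hpos : ∀ i j, 0 < K i j)
    (hsym : ∀ i j, K i j = K j i) (α : ι → ℝ) (hα : ∀ i, 0 ≤ α i) (hs : ∑ i, α i = 1) :
    ∃ a : ι → ℝ, (∀ i, 0 ≤ a i) ∧ ∀ i, a i * ∑ k, K i k * a k = α i := by
  classical
  set q : (ι → ℝ) → ℝ := fun a => ∑ i, ∑ k, a i * (K i k * a k) with hq
  set w : (ι → ℝ) → ℝ := fun a => ∏ i, a i ^ (2 * α i) with hw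
  have qpos : ∀ a : ι → ℝ, (∀ i, 0 ≤ a i) → (∃ i, 0 < a i) → 0 < q a := by
    rintro a ha ⟨i, hi⟩
    have hnn : ∀ i k, 0 ≤ a i * (K i k * a k) := fun i k =>
      mul_nonneg (ha i) (mul_nonneg (hpos i k).le (ha k))
    apply Finset.sum_pos' (fun i _ => Finset.sum_nonneg fun k _ => hnn i k)
    refine ⟨i, Finset.mem_univ _, ?_⟩
    apply Finset.sum_pos' (fun k _ => hnn i k)
    exact ⟨i, Finset.mem_univ _, mul_pos hi (mul_pos (hpos i i) hi)⟩
  have expos : ∀ a : ι → ℝ, (∀ i, 0 ≤ a i) → 0 < ∑ i, a i → ∃ i, 0 < a i := by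
    intro a ha hsum
    by_contra! hcon
    exact absurd (Finset.sum_nonpos fun i _ => hcon i) (not_le.mpr hsum)
  have hne : Nonempty ι := by
    by_contra h
    rw [not_nonempty_iff] at h
    simp at hs
  have hcard : (0 : ℝ) < Fintype.card ι := by exact_mod_cast Fintype.card_pos
  have hcont : ContinuousOn (fun a => w a / q a) (stdSimplex ℝ ι) := by
    apply ContinuousOn.div
    · apply Continuous.continuousOn
      apply continuous_finsetProd
      intro i _
      exact (continuous_apply i).rpow_const (fun x => Or.inr (by have := hα i; positivity))
    · apply Continuous.continuousOn
      simp only [hq]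
      fun_prop
    · intro a ha
      exact (qpos a ha.1 (expos a ha.1 (by rw [ha.2]; exact one_pos))).ne'
  have hunif : (fun _ : ι => (1 : ℝ) / Fintype.card ι) ∈ stdSimplex ℝ ι := by
    refine ⟨fun _ => by positivity, ?_⟩
    simp [hcard.ne']
  obtain ⟨a, ⟨ha0, ha1⟩, hmax⟩ :=
    (isCompact_stdSimplex ℝ ι).exists_isMaxOn ⟨_, hunif⟩ hcont
  have hqa : 0 < q a := qpos a ha0 (expos a ha0 (by rw [ha1]; exact one_pos))
  have hwa : 0 < w a := by
    have h1 := hmax hunif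
    simp only [Set.mem_ofPred_eq] at h1
    have h2 : 0 < w (fun _ : ι => (1 : ℝ) / Fintype.card ι) / q (fun _ : ι => (1 : ℝ) / Fintype.card ι) := by
      apply div_pos
      · apply Finset.prod_pos; intro i _; positivity
      · exact qpos _ hunif.1 ⟨hne.some, by positivity⟩
    have h3 := lt_of_lt_of_le h2 h1
    by_contra hcon
    exact absurd (div_nonpos_of_nonpos_of_nonneg (not_lt.mp hcon) hqa.le) (not_le.mpr h3)
  have whom : ∀ (b : ι → ℝ) (s : ℝ), (∀ i, 0 ≤ b i) → 0 < s →
      w (fun i => b i / s) = w b / s ^ 2 := by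
    intro b s hb hspos
    simp only [hw]
    rw [Finset.prod_congr rfl (fun i _ => Real.div_rpow (hb i) hspos.le (2 * α i)),
      Finset.prod_div_distrib, ← Real.rpow_sum_of_pos hspos, ← Finset.mul_sum, hs]
    norm_num
  have qhom : ∀ (b : ι → ℝ) (s : ℝ), 0 < s →
      q (fun i => b i / s) = q b / s ^ 2 := by
    intro b s hspos
    simp only [hq, Finset.sum_div]
    refine Finset.sum_congr rfl fun i _ => Finset.sum_congr rfl fun k _ => ?_
    field_simp
  have hmax2 : ∀ b : ι → ℝ, (∀ i, 0 ≤ b i) → 0 < ∑ i, b i → w b * q a ≤ w a * q b := by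
    intro b hb hsum
    have hqb := qpos b hb (expos b hb hsum)
    have hmem : (fun i => b i / ∑ i, b i) ∈ stdSimplex ℝ ι := by
      refine ⟨fun i => div_nonneg (hb i) hsum.le, ?_⟩
      rw [← Finset.sum_div, div_self hsum.ne']
    have h1 := hmax hmem
    simp only [Set.mem_ofPred_eq] at h1
    rw [whom b _ hb hsum, qhom b _ hsum, div_div_div_cancel_right₀ (by positivity),
      div_le_div_iff₀ hqb hqa] at h1
    exact h1
  have hfo : ∀ i, a i * ∑ k, K i k * a k = α i * q a := by
    intro i
    set p := a i * ∑ k, K i k * a k with hp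
    set r := a i * (K i i * a i) with hr
    have key : ∀ t : ℝ, Real.exp (t * (2 * α i)) * q a ≤
        q a + 2 * (Real.exp t - 1) * p + (Real.exp t - 1) ^ 2 * r := by
      intro t
      set x := Real.exp t - 1 with hx
      set d : ι → ℝ := fun k => if k = i then x * a i else 0 with hd
      set b : ι → ℝ := fun k => a k * (if k = i then Real.exp t else 1) with hb
      have hbd : ∀ k, b k = a k + d k := by
        intro k
        simp only [hb, hd, hx]
        split_ifs with h
        · subst h; ring
        · ring
      have hb0 : ∀ k, 0 ≤ b k := by
        intro k
        apply mul_nonneg (ha0 k)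
        split_ifs <;> positivity
      have hbs : 0 < ∑ k, b k := by
        obtain ⟨k, hk⟩ := expos a ha0 (by rw [ha1]; exact one_pos)
        apply Finset.sum_pos' (fun k _ => hb0 k)
        refine ⟨k, Finset.mem_univ _, mul_pos hk ?_⟩
        split_ifs <;> positivity
      have hwb : w b = w a * Real.exp (t * (2 * α i)) := by
        simp only [hw, hb]
        rw [Finset.prod_congr rfl (fun k _ => Real.mul_rpow (z := 2 * α k) (ha0 k)
          (show 0 ≤ (if k = i then Real.exp t else 1) by split_ifs <;> positivity)),
          Finset.prod_mul_distrib]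
        congr 1
        rw [Finset.prod_eq_single i]
        · simp [Real.exp_mul]
        · intro k _ hk; simp [hk]
        · simp
      have hqb : q b = q a + 2 * x * p + x ^ 2 * r := by
        have e1 : q b = q a + (∑ i, ∑ k, d i * (K i k * a k)) + (∑ i, ∑ k, a i * (K i k * d k))
            + ∑ i, ∑ k, d i * (K i k * d k) := by
          simp only [hq, ← Finset.sum_add_distrib]
          refine Finset.sum_congr rfl fun i _ => Finset.sum_congr rfl fun k _ => ?_
          rw [hbd, hbd]; ring
        have e2 : (∑ j, ∑ k, d j * (K j k * a k)) = x * p := by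
          rw [Finset.sum_eq_single i (fun j _ hj => by simp [hd, hj]) (by simp)]
          simp only [hd, ← Finset.mul_sum, if_true, hp]
          ring
        have e3 : (∑ j, ∑ k, a j * (K j k * d k)) = x * p := by
          rw [← e2, Finset.sum_comm]
          refine Finset.sum_congr rfl fun i _ => Finset.sum_congr rfl fun k _ => ?_
          rw [hsym]; ring
        have e4 : (∑ j, ∑ k, d j * (K j k * d k)) = x ^ 2 * r := by
          rw [Finset.sum_eq_single i (fun j _ hj => by simp [hd, hj]) (by simp),
            Finset.sum_eq_single i (fun j _ hj => by simp [hd, hj]) (by simp)]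
          simp only [hd, if_true, hr]
          ring
        rw [e1, e2, e3, e4]; ring
      have h1 := hmax2 b hb0 hbs
      rw [hwb, hqb, mul_assoc] at h1
      exact le_of_mul_le_mul_left h1 hwa
    set g : ℝ → ℝ := fun t => q a + 2 * (Real.exp t - 1) * p + (Real.exp t - 1) ^ 2 * r
      - Real.exp (t * (2 * α i)) * q a with hg
    have hmin : IsLocalMin g 0 := by
      apply Filter.Eventually.of_forall
      intro t
      have := key t
      simp only [hg]
      simp
      linarith
    have hE : HasDerivAt (fun t : ℝ => Real.exp t - 1) 1 0 := by
      simpa using (Real.hasDerivAt_exp 0).sub_const 1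
    have hE2 : HasDerivAt (fun t : ℝ => Real.exp (t * (2 * α i))) (2 * α i) 0 := by
      simpa using ((hasDerivAt_id (0 : ℝ)).mul_const (2 * α i)).exp
    have hder : HasDerivAt g (2 * p - 2 * α i * q a) 0 := by
      have := ((((hE.const_mul 2).mul_const p).const_add (q a)).add
        ((hE.pow 2).mul_const r)).sub (hE2.mul_const (q a))
      exact this.congr_deriv (by simp)
    have := hmin.hasDerivAt_eq_zero hder
    linarith
  have hsq : 0 < Real.sqrt (q a) := Real.sqrt_pos.mpr hqa
  refine ⟨fun i => a i / Real.sqrt (q a), fun i => div_nonneg (ha0 i) hsq.le, fun i => ?_⟩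
  have h1 := hfo i
  have : (∑ k, K i k * (a k / Real.sqrt (q a))) = (∑ k, K i k * a k) / Real.sqrt (q a) := by
    rw [Finset.sum_div]
    exact Finset.sum_congr rfl fun k _ => by ring
  rw [this, div_mul_div_comm, h1, Real.mul_self_sqrt hqa.le]
  field_simp

lemma aux_pt_lower {p α β a b c ε : ℝ} (hε : 0 < ε) (hp : 0 ≤ p) (ha : 0 ≤ a) (hb : 0 ≤ b)
    (h : 0 < p → 0 < α ∧ 0 < β ∧ 0 < a ∧ 0 < b) :
    ε * (p * Real.log (a / α) + p * Real.log (b / β) + p - a * (Real.exp (-c / ε) * b))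
      ≤ c * p + ε * (p * Real.log (p / (α * β))) := by
  rcases hp.eq_or_lt with rfl | hp
  · have : 0 ≤ ε * (a * (Real.exp (-c / ε) * b)) := by positivity
    simp
    exact this
  · obtain ⟨h1, h2, h3, h4⟩ := h hp
    set k := Real.exp (-c / ε) with hk
    have hkp : 0 < k := Real.exp_pos _
    have hlog : Real.log k = -c / ε := Real.log_exp _
    have hy : 0 < a * (k * b) := by positivity
    have h5 := Real.log_le_sub_one_of_pos (div_pos hy hp)
    rw [Real.log_div hy.ne' hp.ne', Real.log_mul h3.ne' (mul_pos hkp h4).ne',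
      Real.log_mul hkp.ne' h4.ne', hlog] at h5
    have h6 := mul_le_mul_of_nonneg_left h5 hp.le
    have h7 : p * (a * (k * b) / p - 1) = a * (k * b) - p := by field_simp
    rw [h7] at h6
    have h8 := mul_le_mul_of_nonneg_left h6 hε.le
    rw [Real.log_div h3.ne' h1.ne', Real.log_div h4.ne' h2.ne',
      Real.log_div hp.ne' (mul_pos h1 h2).ne', Real.log_mul h1.ne' h2.ne']
    have h9 : ε * (p * (Real.log a + (-c / ε + Real.log b) - Real.log p)) =
      ε * (p * (Real.log a + Real.log b - Real.log p)) - c * p := by field_simp; ring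
    rw [h9] at h8
    linarith

lemma aux_pt_eq {α β a b c ε : ℝ} (hε : 0 < ε) (ha : 0 ≤ a) (hb : 0 ≤ b)
    (hα : 0 < a → 0 < α) (hβ : 0 < b → 0 < β) :
    c * (a * (Real.exp (-c / ε) * b)) + ε * ((a * (Real.exp (-c / ε) * b)) *
      Real.log ((a * (Real.exp (-c / ε) * b)) / (α * β)))
    = ε * ((a * (Real.exp (-c / ε) * b)) * Real.log (a / α) +
      (a * (Real.exp (-c / ε) * b)) * Real.log (b / β)) := by
  rcases ha.eq_or_lt with rfl | ha
  · simp
  rcases hb.eq_or_lt with rfl | hb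
  · simp
  have h1 := hα ha
  have h2 := hβ hb
  set k := Real.exp (-c / ε) with hk
  have hkp : 0 < k := Real.exp_pos _
  have hlog : Real.log k = -c / ε := Real.log_exp _
  rw [Real.log_div (by positivity) (by positivity), Real.log_mul ha.ne' (mul_pos hkp hb).ne',
      Real.log_mul hkp.ne' hb.ne', hlog, Real.log_mul h1.ne' h2.ne', Real.log_div ha.ne' h1.ne',
      Real.log_div hb.ne' h2.ne']
  field_simp
  ring

/-- real objective on `ι × ι`. -/
noncomputable def auxObj (c : ι → ι → ℝ) (ε : ℝ) (p : ι → ι → ℝ) (α β : ι → ℝ) : ℝ :=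
  ∑ u, ∑ v, (c u v * p u v + ε * (p u v * Real.log (p u v / (α u * β v))))

lemma aux_obj_eq (c : ι → ι → ℝ) (ε : ℝ) (hε : 0 < ε) (hc : ∀ u v, c u v = c v u)
    (α a : ι → ℝ) (ha : ∀ u, 0 ≤ a u) (hpos : ∀ u, 0 < a u → 0 < α u)
    (h : ∀ u, a u * ∑ v, Real.exp (-c u v / ε) * a v = α u) :
    auxObj c ε (fun u v => a u * (Real.exp (-c u v / ε) * a v)) α α
      = 2 * (ε * ∑ u, α u * Real.log (a u / α u)) := by
  have e : auxObj c ε (fun u v => a u * (Real.exp (-c u v / ε) * a v)) α α =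
     ε * ((∑ u, ∑ v, (a u * (Real.exp (-c u v / ε) * a v)) * Real.log (a u / α u)) +
      ∑ u, ∑ v, (a u * (Real.exp (-c u v / ε) * a v)) * Real.log (a v / α v)) := by
    simp only [auxObj, Finset.mul_sum, ← Finset.sum_add_distrib]
    refine Finset.sum_congr rfl fun u _ => Finset.sum_congr rfl fun v _ => ?_
    exact aux_pt_eq hε (ha u) (ha v) (hpos u) (hpos v)
  have e1 : (∑ u, ∑ v, (a u * (Real.exp (-c u v / ε) * a v)) * Real.log (a u / α u)) =
      ∑ u, α u * Real.log (a u / α u) := by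
    refine Finset.sum_congr rfl fun u _ => ?_
    rw [← Finset.sum_mul, ← Finset.mul_sum, h]
  have e2 : (∑ u, ∑ v, (a u * (Real.exp (-c u v / ε) * a v)) * Real.log (a v / α v)) =
      ∑ u, α u * Real.log (a u / α u) := by
    rw [← e1, Finset.sum_comm]
    refine Finset.sum_congr rfl fun u _ => Finset.sum_congr rfl fun v _ => ?_
    rw [hc v u]; ring
  rw [e, e1, e2]; ring

lemma aux_obj_lower (c : ι → ι → ℝ) (ε : ℝ) (hε : 0 < ε) (p : ι → ι → ℝ) (hp : ∀ u v, 0 ≤ p u v)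
    (α β a b : ι → ℝ) (hα : ∀ u, ∑ v, p u v = α u) (hβ : ∀ v, ∑ u, p u v = β v)
    (hs : ∑ u, α u = 1)
    (ha : ∀ u, 0 ≤ a u) (hb : ∀ u, 0 ≤ b u)
    (hap : ∀ u, 0 < α u → 0 < a u) (hbp : ∀ u, 0 < β u → 0 < b u) :
    ε * ((∑ u, α u * Real.log (a u / α u)) + (∑ u, β u * Real.log (b u / β u)) + 1
      - ∑ u, ∑ v, a u * (Real.exp (-c u v / ε) * b v)) ≤ auxObj c ε p α β := by
  have e1 : (∑ u, α u * Real.log (a u / α u)) = ∑ u, ∑ v, p u v * Real.log (a u / α u) := by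
    refine Finset.sum_congr rfl fun u _ => ?_
    rw [← Finset.sum_mul, hα]
  have e2 : (∑ u, β u * Real.log (b u / β u)) = ∑ u, ∑ v, p u v * Real.log (b v / β v) := by
    rw [Finset.sum_comm]
    refine Finset.sum_congr rfl fun u _ => ?_
    rw [← Finset.sum_mul, hβ]
  have e3 : (1 : ℝ) = ∑ u, ∑ v, p u v := by simp only [hα, hs]
  rw [e1, e2, e3]
  simp only [auxObj, Finset.mul_sum, ← Finset.sum_add_distrib, ← Finset.sum_sub_distrib]
  refine Finset.sum_le_sum fun u _ => Finset.sum_le_sum fun v _ => ?_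
  apply aux_pt_lower hε (hp u v) (ha u) (hb v)
  intro h
  have h1 : 0 < α u := by
    rw [← hα]
    exact Finset.sum_pos' (fun v _ => hp u v) ⟨v, Finset.mem_univ _, h⟩
  have h2 : 0 < β v := by
    rw [← hβ]
    exact Finset.sum_pos' (fun u _ => hp u v) ⟨u, Finset.mem_univ _, h⟩
  exact ⟨h1, h2, hap u h1, hbp v h2⟩

lemma aux_supp (K : ι → ι → ℝ) (hpos : ∀ i j, 0 < K i j) (α a : ι → ℝ) (ha : ∀ u, 0 ≤ a u)
    (h : ∀ u, a u * ∑ v, K u v * a v = α u) (u : ι) : 0 < a u ↔ 0 < α u := by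
  rw [← h]
  constructor
  · intro hu
    apply mul_pos hu
    exact Finset.sum_pos' (fun v _ => mul_nonneg (hpos u v).le (ha v))
      ⟨u, Finset.mem_univ _, mul_pos (hpos u u) hu⟩
  · intro hu
    rcases (ha u).eq_or_lt with h0 | h0
    · rw [← h0] at hu; simp at hu
    · exact h0

lemma aux_main (c : ι → ι → ℝ) (ε : ℝ) (hε : 0 < ε) (hc : ∀ u v, c u v = c v u)
    (hK : (Matrix.of fun u v : ι => Real.exp (-c u v / ε)).PosDef)
    (p : ι → ι → ℝ) (hp : ∀ u v, 0 ≤ p u v)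
    (α β : ι → ℝ) (hα : ∀ u, ∑ v, p u v = α u) (hβ : ∀ v, ∑ u, p u v = β v)
    (hs : ∑ u, α u = 1)
    (hmin : ∀ (γ : ι → ℝ) (r : ι → ι → ℝ), (γ = α ∨ γ = β) → (∀ u v, 0 ≤ r u v) →
      (∀ u, ∑ v, r u v = γ u) → (∀ v, ∑ u, r u v = γ v) →
      auxObj c ε p α β ≤ auxObj c ε r γ γ) : α = β := by
  classical
  have hKp : ∀ u v, 0 < Real.exp (-c u v / ε) := fun u v => Real.exp_pos _
  have hKs : ∀ u v, Real.exp (-c u v / ε) = Real.exp (-c v u / ε) := fun u v => by rw [hc]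
  have hα0 : ∀ u, 0 ≤ α u := fun u => by rw [← hα]; exact Finset.sum_nonneg fun v _ => hp u v
  have hβ0 : ∀ u, 0 ≤ β u := fun u => by rw [← hβ]; exact Finset.sum_nonneg fun v _ => hp v u
  have hsβ : ∑ u, β u = 1 := by
    rw [← hs]; simp only [← hα, ← hβ]; exact Finset.sum_comm
  obtain ⟨a, ha, hae⟩ := aux_scaling _ hKp hKs α hα0 hs
  obtain ⟨b, hb, hbe⟩ := aux_scaling _ hKp hKs β hβ0 hsβ
  have hsa := aux_supp _ hKp α a ha hae
  have hsb := aux_supp _ hKp β b hb hbe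
  have gen : ∀ γ d : ι → ℝ, (γ = α ∨ γ = β) → (∀ u, 0 ≤ d u) →
      (∀ u, d u * ∑ v, Real.exp (-c u v / ε) * d v = γ u) → (∀ u, 0 < d u → 0 < γ u) →
      auxObj c ε p α β ≤ 2 * (ε * ∑ u, γ u * Real.log (d u / γ u)) := by
    intro γ d hγ hd hde hsd
    rw [← aux_obj_eq c ε hε hc γ d hd hsd hde]
    have hrow : ∀ u, ∑ v, d u * (Real.exp (-c u v / ε) * d v) = γ u := by
      intro u; rw [← Finset.mul_sum]; exact hde u
    apply hmin γ _ hγ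
    · intro u v
      have := hd u
      have := hd v
      positivity
    · exact hrow
    · intro v
      rw [← hrow v]
      refine Finset.sum_congr rfl fun u _ => ?_
      rw [hc u v]; ring
  have g1 := gen α a (Or.inl rfl) ha hae (fun u => (hsa u).1)
  have g2 := gen β b (Or.inr rfl) hb hbe (fun u => (hsb u).1)
  have g3 := aux_obj_lower c ε hε p hp α β a b hα hβ hs ha hb (fun u => (hsa u).2)
    (fun u => (hsb u).2)
  have g4 : ε * (1 - ∑ u, ∑ v, a u * (Real.exp (-c u v / ε) * b v)) ≤ 0 := by linarith
  have g5 : 1 - ∑ u, ∑ v, a u * (Real.exp (-c u v / ε) * b v) ≤ 0 := by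
    by_contra hcon
    exact absurd (mul_pos hε (not_le.mp hcon)) (not_lt.mpr g4)
  have qa : ∑ u, ∑ v, a u * (Real.exp (-c u v / ε) * a v) = 1 := by
    rw [← hs]
    exact Finset.sum_congr rfl fun u _ => by rw [← Finset.mul_sum, hae]
  have qb : ∑ u, ∑ v, b u * (Real.exp (-c u v / ε) * b v) = 1 := by
    rw [← hsβ]
    exact Finset.sum_congr rfl fun u _ => by rw [← Finset.mul_sum, hbe]
  have qba : ∑ u, ∑ v, b u * (Real.exp (-c u v / ε) * a v) =
      ∑ u, ∑ v, a u * (Real.exp (-c u v / ε) * b v) := by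
    rw [Finset.sum_comm]
    refine Finset.sum_congr rfl fun u _ => Finset.sum_congr rfl fun v _ => ?_
    rw [hc u v]; ring
  have qd : ∑ u, ∑ v, (a u - b u) * (Real.exp (-c u v / ε) * (a v - b v)) =
      1 + 1 - 2 * ∑ u, ∑ v, a u * (Real.exp (-c u v / ε) * b v) := by
    rw [two_mul]
    nth_rewrite 1 [← qa]
    rw [← qb]
    nth_rewrite 2 [← qba]
    simp only [← Finset.sum_add_distrib, ← Finset.sum_sub_distrib]
    refine Finset.sum_congr rfl fun u _ => Finset.sum_congr rfl fun v _ => ?_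
    ring
  have hab : a = b := by
    by_contra hne
    have h1 := hK.dotProduct_mulVec_pos (x := a - b) (sub_ne_zero.mpr hne)
    have h2 : star (a - b) ⬝ᵥ (Matrix.of fun u v : ι => Real.exp (-c u v / ε)).mulVec (a - b)
      = ∑ u, ∑ v, (a u - b u) * (Real.exp (-c u v / ε) * (a v - b v)) := by
      simp [dotProduct, Matrix.mulVec, Finset.mul_sum]
    rw [h2, qd] at h1
    linarith
  funext u
  rw [← hae, ← hbe, hab]

end Abstract

/-- Real form of the objective. -/
lemma dcObj4_eq_s16 {m n : ℕ} (C : Fin m → Fin n → Fin m → Fin n → ℝ) (ε : ℝ)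
    (P : Fin m → Fin n → Fin m → Fin n → ℝ) (hP : ∀ i j k l, 0 ≤ P i j k l) :
    dcObj4 C ε P = ((auxObj (fun u v : Fin m × Fin n => C u.1 u.2 v.1 v.2) ε
      (fun u v => P u.1 u.2 v.1 v.2) (fun u => marg12 P u.1 u.2)
      (fun v => marg34 P v.1 v.2) : ℝ) : EReal) := by
  have hac : ∀ i j k l, prodMarg4 P i j k l = 0 → P i j k l = 0 := by
    intro i j k l h
    by_contra hne
    have hpos : 0 < P i j k l := lt_of_le_of_ne (hP i j k l) (Ne.symm hne)
    have h1 : 0 < marg12 P i j :=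
      Finset.sum_pos' (fun k _ => Finset.sum_nonneg fun l _ => hP i j k l)
        ⟨k, Finset.mem_univ _, Finset.sum_pos' (fun l _ => hP i j k l) ⟨l, Finset.mem_univ _, hpos⟩⟩
    have h2 : 0 < marg34 P k l :=
      Finset.sum_pos' (fun i _ => Finset.sum_nonneg fun j _ => hP i j k l)
        ⟨i, Finset.mem_univ _, Finset.sum_pos' (fun j _ => hP i j k l) ⟨j, Finset.mem_univ _, hpos⟩⟩
    exact (mul_pos h1 h2).ne' h
  unfold dcObj4 KL4
  rw [if_pos hac, ← EReal.coe_mul, ← EReal.coe_add]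
  congr 1
  simp only [auxObj, inner4, prodMarg4, Fintype.sum_prod_type, Finset.mul_sum,
    Finset.sum_add_distrib]

/-- In the 4-D setting with `T_1 = (1,2)`, `T_2 = (3,4)`, `μ_1 = μ_3`,
`μ_2 = μ_4`, a symmetric cost `C_{i,j,k,l} = C_{k,l,i,j}` whose Gibbs kernel
`exp(−C/ε)` is a positive definite `(mn)×(mn)` matrix, every minimizer `P_ε` of
`MMOT-DC_ε` has equal block marginals: `(P_ε)_{#1} = (P_ε)_{#2}`. -/
theorem marginals_eq_of_posdef_kernel {m n : ℕ} (hm : 0 < m) (hn : 0 < n)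
    (μ1 μ3 : Fin m → ℝ) (μ2 μ4 : Fin n → ℝ)
    (hμ1 : (∀ i, 0 ≤ μ1 i) ∧ ∑ i, μ1 i = 1)
    (hμ2 : (∀ j, 0 ≤ μ2 j) ∧ ∑ j, μ2 j = 1)
    (hμ3 : (∀ i, 0 ≤ μ3 i) ∧ ∑ i, μ3 i = 1)
    (hμ4 : (∀ j, 0 ≤ μ4 j) ∧ ∑ j, μ4 j = 1)
    (h13 : μ1 = μ3) (h24 : μ2 = μ4)
    (C : Fin m → Fin n → Fin m → Fin n → ℝ)
    (hCsym : ∀ i j k l, C i j k l = C k l i j)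
    (ε : ℝ) (hε : 0 < ε)
    (hK : (Matrix.of fun u v : Fin m × Fin n =>
      Real.exp (-(C u.1 u.2 v.1 v.2) / ε)).PosDef)
    (P : Fin m → Fin n → Fin m → Fin n → ℝ)
    (hPmem : P ∈ UT4 μ1 μ2 μ3 μ4)
    (hPmin : ∀ Q ∈ UT4 μ1 μ2 μ3 μ4, dcObj4 C ε P ≤ dcObj4 C ε Q) :
    marg12 P = marg34 P := by
  obtain ⟨⟨hP0, hP1⟩, hm1, hm2, hm3, hm4⟩ := hPmem
  have e1 : ∀ i, ∑ j, marg12 P i j = μ1 i := fun i => by rw [← hm1]; rfl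
  have e2 : ∀ j, ∑ i, marg12 P i j = μ2 j := fun j => by rw [← hm2]; rfl
  have e3 : ∀ k, ∑ l, marg34 P k l = μ3 k := fun k => by
    rw [← hm3]; simp only [marg34, marg3]
    rw [Finset.sum_comm]
    exact Finset.sum_congr rfl fun i _ => Finset.sum_comm
  have e4 : ∀ l, ∑ k, marg34 P k l = μ4 l := fun l => by
    rw [← hm4]; simp only [marg34, marg4]
    rw [Finset.sum_comm]
    exact Finset.sum_congr rfl fun i _ => Finset.sum_comm
  have key := aux_main (fun u v : Fin m × Fin n => C u.1 u.2 v.1 v.2) ε hε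
    (fun u v => hCsym _ _ _ _) hK (fun u v => P u.1 u.2 v.1 v.2) (fun u v => hP0 _ _ _ _)
    (fun u => marg12 P u.1 u.2) (fun v => marg34 P v.1 v.2)
    (fun u => by simp only [Fintype.sum_prod_type]; rfl)
    (fun u => by simp only [Fintype.sum_prod_type]; rfl)
    (by simp only [Fintype.sum_prod_type, e1]; exact hμ1.2) ?_
  · funext i j
    exact congrFun key (i, j)
  · intro γ r hγ hr hrow hcol
    set Q : Fin m → Fin n → Fin m → Fin n → ℝ := fun i j k l => r (i, j) (k, l) with hQ
    have q12 : ∀ i j, marg12 Q i j = γ (i, j) := fun i j => by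
      rw [← hrow, Fintype.sum_prod_type]; rfl
    have q34 : ∀ i j, marg34 Q i j = γ (i, j) := fun i j => by
      rw [← hcol, Fintype.sum_prod_type]; rfl
    have g1 : ∀ i, ∑ j, γ (i, j) = μ1 i := by
      intro i
      rcases hγ with rfl | rfl
      · exact e1 i
      · rw [h13]; exact e3 i
    have g2 : ∀ j, ∑ i, γ (i, j) = μ2 j := by
      intro j
      rcases hγ with rfl | rfl
      · exact e2 j
      · rw [h24]; exact e4 j
    have hQ0 : ∀ i j k l, 0 ≤ Q i j k l := fun i j k l => hr _ _
    have s1 : marg1 Q = μ1 := by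
      funext i
      rw [← g1]
      exact Finset.sum_congr rfl fun j _ => q12 i j
    have hmem : Q ∈ UT4 μ1 μ2 μ3 μ4 := by
      refine ⟨⟨hQ0, ?_⟩, s1, ?_, ?_, ?_⟩
      · rw [← hμ1.2, ← s1]; rfl
      · funext j
        rw [← g2]
        exact Finset.sum_congr rfl fun i _ => q12 i j
      · funext k
        rw [← h13, ← g1]
        simp only [← q34, marg34, marg3]
        symm
        rw [Finset.sum_comm]
        exact Finset.sum_congr rfl fun i _ => Finset.sum_comm
      · funext l
        rw [← h24, ← g2]
        simp only [← q34, marg34, marg4]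
        symm
        rw [Finset.sum_comm]
        exact Finset.sum_congr rfl fun i _ => Finset.sum_comm
    have h := hPmin Q hmem
    rw [dcObj4_eq_s16 C ε P hP0, dcObj4_eq_s16 C ε Q hQ0, EReal.coe_le_coe_iff] at h
    simp only [q12, q34] at h
    exact h

end MMOT4
end

section
/- Suppose C_x and C_y are symmetric, so that the 4-D cost tensor C = L_p(C_x,C_y) satisfies C_{i,j,k,l} = C_{k,l,i,j}, and suppose that for every ε > 0 the (mn)×(mn) matrix K_ε with entries (K_ε)_{(i,j),(k,l)} = exp(−C_{i,j,k,l}/ε) is a positive definite matrix (i.e., exp(−C/ε) is a strictly positive definite kernel on ([m]×[n])²). Then COOT admits a solution (P,Q) with P = Q, and consequently GW(C_x,C_y) = COOT(C_x,C_y). -/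
open scoped BigOperators

namespace COOTGW

variable {m n : ℕ}

/-- The 4-D cost tensor `L_p(C_x, C_y)_{i,j,k,l} = |C_x(i,k) − C_y(j,l)|^p`. -/
noncomputable def Lp (Cx : Fin m → Fin m → ℝ) (Cy : Fin n → Fin n → ℝ) (p : ℝ)
    (i : Fin m) (j : Fin n) (k : Fin m) (l : Fin n) : ℝ :=
  |Cx i k - Cy j l| ^ p

/-- `U(μ_x, μ_y)`: nonnegative matrices with row sums `μ_x` and column sums `μ_y`. -/
def U2 (μx : Fin m → ℝ) (μy : Fin n → ℝ) : Set (Fin m → Fin n → ℝ) :=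
  {P | (∀ i j, 0 ≤ P i j) ∧ (∀ i, ∑ j, P i j = μx i) ∧ (∀ j, ∑ i, P i j = μy j)}

/-- `⟨L_p(C_x,C_y), P ⊗ Q⟩`. -/
noncomputable def cost (Cx : Fin m → Fin m → ℝ) (Cy : Fin n → Fin n → ℝ) (p : ℝ)
    (P Q : Fin m → Fin n → ℝ) : ℝ :=
  ∑ i, ∑ j, ∑ k, ∑ l, Lp Cx Cy p i j k l * (P i j * Q k l)

/-- The Gromov–Wasserstein value `inf_{P ∈ U(μx,μy)} ⟨L_p, P ⊗ P⟩`. -/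
noncomputable def GWval (Cx : Fin m → Fin m → ℝ) (Cy : Fin n → Fin n → ℝ) (p : ℝ)
    (μx : Fin m → ℝ) (μy : Fin n → ℝ) : ℝ :=
  sInf ((fun P => cost Cx Cy p P P) '' U2 μx μy)

/-- The CO-Optimal Transport value `inf_{P,Q ∈ U(μx,μy)} ⟨L_p, P ⊗ Q⟩`. -/
noncomputable def COOTval (Cx : Fin m → Fin m → ℝ) (Cy : Fin n → Fin n → ℝ) (p : ℝ)
    (μx : Fin m → ℝ) (μy : Fin n → ℝ) : ℝ :=
  sInf {c | ∃ P ∈ U2 μx μy, ∃ Q ∈ U2 μx μy, c = cost Cx Cy p P Q}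

lemma cnd {ι : Type*} [Fintype ι] (C : ι → ι → ℝ)
    (h : ∀ ε : ℝ, 0 < ε → (Matrix.of fun u v : ι => Real.exp (-(C u v) / ε)).PosSemidef)
    (x : ι → ℝ) (hx : ∑ u, x u = 0) : ∑ u, ∑ v, x u * x v * C u v ≤ 0 := by
  have hd : HasDerivAt (fun t : ℝ => ∑ u, ∑ v, x u * x v * Real.exp (t * -(C u v)))
      (∑ u, ∑ v, x u * x v * -(C u v)) 0 := by
    apply HasDerivAt.fun_sum
    intro u _
    apply HasDerivAt.fun_sum
    intro v _
    apply HasDerivAt.const_mul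
    simpa using ((hasDerivAt_id (0 : ℝ)).mul_const (-(C u v))).exp
  have h0 : ∑ u, ∑ v, x u * x v * Real.exp ((0 : ℝ) * -(C u v)) = 0 := by
    simp [← Finset.mul_sum, hx]
  have hlim := hd.tendsto_slope_zero_right
  have hge : 0 ≤ ∑ u, ∑ v, x u * x v * -(C u v) := by
    refine ge_of_tendsto hlim ?_
    filter_upwards [self_mem_nhdsWithin] with t ht
    have ht : 0 < t := ht
    rw [h0, sub_zero, zero_add, smul_eq_mul]
    refine mul_nonneg (inv_nonneg.mpr ht.le) ?_
    have := (h t⁻¹ (inv_pos.mpr ht)).dotProduct_mulVec_nonneg x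
    refine this.trans_eq ?_
    simp only [dotProduct, Matrix.mulVec, Matrix.of_apply, Finset.mul_sum, Pi.star_apply,
      star_trivial]
    refine Finset.sum_congr rfl fun u _ => Finset.sum_congr rfl fun v _ => ?_
    rw [div_inv_eq_mul, mul_comm (-(C u v)) t]
    ring
  simp only [mul_neg, Finset.sum_neg_distrib] at hge
  linarith

lemma cost_eq {m n : ℕ} (Cx : Fin m → Fin m → ℝ) (Cy : Fin n → Fin n → ℝ) (p : ℝ)
    (P Q : Fin m → Fin n → ℝ) :
    cost Cx Cy p P Q = ∑ u : Fin m × Fin n, ∑ v : Fin m × Fin n,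
      P u.1 u.2 * Q v.1 v.2 * Lp Cx Cy p u.1 u.2 v.1 v.2 := by
  simp only [cost, Fintype.sum_prod_type]
  refine Finset.sum_congr rfl fun i _ => Finset.sum_congr rfl fun j _ =>
    Finset.sum_congr rfl fun k _ => Finset.sum_congr rfl fun l _ => ?_
  ring

lemma cost_symm {m n : ℕ} (Cx : Fin m → Fin m → ℝ) (Cy : Fin n → Fin n → ℝ)
    (hCx : ∀ i k, Cx i k = Cx k i) (hCy : ∀ j l, Cy j l = Cy l j) (p : ℝ)
    (P Q : Fin m → Fin n → ℝ) : cost Cx Cy p P Q = cost Cx Cy p Q P := by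
  rw [cost_eq, cost_eq, Finset.sum_comm]
  refine Finset.sum_congr rfl fun u _ => Finset.sum_congr rfl fun v _ => ?_
  rw [Lp, Lp, hCx, hCy]
  ring

lemma isCompact_U2 {m n : ℕ} (μx : Fin m → ℝ) (μy : Fin n → ℝ) :
    IsCompact (U2 μx μy) := by
  have hb : U2 μx μy ⊆ Set.Icc (fun _ _ => 0) (fun i _ => μx i) := by
    rintro P ⟨h0, h1, _⟩
    refine ⟨fun i j => h0 i j, fun i j => ?_⟩
    show P i j ≤ μx i
    rw [← h1 i]
    exact Finset.single_le_sum (fun j _ => h0 i j) (Finset.mem_univ j)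
  refine IsCompact.of_isClosed_subset isCompact_Icc ?_ hb
  have : U2 μx μy = (⋂ i, ⋂ j, {P | 0 ≤ P i j}) ∩ ((⋂ i, {P | ∑ j, P i j = μx i}) ∩
      (⋂ j, {P | ∑ i, P i j = μy j})) := by
    ext P; simp [U2]
  rw [this]
  refine IsClosed.inter ?_ (IsClosed.inter ?_ ?_)
  · exact isClosed_iInter fun i => isClosed_iInter fun j =>
      isClosed_le continuous_const (by fun_prop)
  · exact isClosed_iInter fun i => isClosed_eq (by fun_prop) continuous_const
  · exact isClosed_iInter fun i => isClosed_eq (by fun_prop) continuous_const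

/-- If `C_x`, `C_y` are symmetric and for every `ε > 0` the Gibbs
kernel `exp(−L_p(C_x,C_y)/ε)` is a positive definite `(mn)×(mn)` matrix, then
COOT admits a solution `(P, Q)` with `P = Q`, and consequently `GW = COOT`. -/
theorem coot_has_symmetric_solution_and_gw_eq_coot {m n : ℕ} (hm : 0 < m) (hn : 0 < n)
    (Cx : Fin m → Fin m → ℝ) (Cy : Fin n → Fin n → ℝ)
    (hCx : ∀ i k, Cx i k = Cx k i) (hCy : ∀ j l, Cy j l = Cy l j)
    (p : ℝ) (hp : 1 ≤ p)
    (μx : Fin m → ℝ) (μy : Fin n → ℝ)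
    (hμx : (∀ i, 0 ≤ μx i) ∧ ∑ i, μx i = 1)
    (hμy : (∀ j, 0 ≤ μy j) ∧ ∑ j, μy j = 1)
    (hK : ∀ ε : ℝ, 0 < ε →
      (Matrix.of fun u v : Fin m × Fin n =>
        Real.exp (-(Lp Cx Cy p u.1 u.2 v.1 v.2) / ε)).PosDef) :
    (∃ P ∈ U2 μx μy, ∀ P' ∈ U2 μx μy, ∀ Q' ∈ U2 μx μy,
        cost Cx Cy p P P ≤ cost Cx Cy p P' Q') ∧
      GWval Cx Cy p μx μy = COOTval Cx Cy p μx μy := by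
  have key : ∀ P ∈ U2 μx μy, ∀ Q ∈ U2 μx μy,
      cost Cx Cy p P P + cost Cx Cy p Q Q ≤ 2 * cost Cx Cy p P Q := by
    intro P hP Q hQ
    have h := cnd (fun u v : Fin m × Fin n => Lp Cx Cy p u.1 u.2 v.1 v.2)
      (fun ε hε => (hK ε hε).posSemidef) (fun u => P u.1 u.2 - Q u.1 u.2) (by
        rw [Fintype.sum_prod_type]
        simp [Finset.sum_sub_distrib, hP.2.1, hQ.2.1])
    have e : ∑ u : Fin m × Fin n, ∑ v : Fin m × Fin n, (P u.1 u.2 - Q u.1 u.2) *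
        (P v.1 v.2 - Q v.1 v.2) * Lp Cx Cy p u.1 u.2 v.1 v.2 =
        cost Cx Cy p P P - cost Cx Cy p P Q - cost Cx Cy p Q P + cost Cx Cy p Q Q := by
      simp only [cost_eq, ← Finset.sum_sub_distrib, ← Finset.sum_add_distrib]
      refine Finset.sum_congr rfl fun u _ => Finset.sum_congr rfl fun v _ => ?_
      ring
    have s := cost_symm Cx Cy hCx hCy p P Q
    linarith
  have hne : (U2 μx μy).Nonempty := by
    refine ⟨fun i j => μx i * μy j, fun i j => mul_nonneg (hμx.1 i) (hμy.1 j), fun i => ?_,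
      fun j => ?_⟩
    · rw [← Finset.mul_sum, hμy.2, mul_one]
    · rw [← Finset.sum_mul, hμx.2, one_mul]
  have hcont : Continuous fun P : Fin m → Fin n → ℝ => cost Cx Cy p P P := by
    unfold cost
    fun_prop
  obtain ⟨P, hP, hmin⟩ := (isCompact_U2 μx μy).exists_isMinOn hne hcont.continuousOn
  have hmin' : ∀ Q ∈ U2 μx μy, cost Cx Cy p P P ≤ cost Cx Cy p Q Q := fun Q hQ => hmin hQ
  have hopt : ∀ P' ∈ U2 μx μy, ∀ Q' ∈ U2 μx μy,
      cost Cx Cy p P P ≤ cost Cx Cy p P' Q' := by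
    intro P' hP' Q' hQ'
    have := key P' hP' Q' hQ'
    have := hmin' P' hP'
    have := hmin' Q' hQ'
    linarith
  refine ⟨⟨P, hP, hopt⟩, ?_⟩
  have h1 : IsLeast ((fun P => cost Cx Cy p P P) '' U2 μx μy) (cost Cx Cy p P P) := by
    refine ⟨⟨P, hP, rfl⟩, ?_⟩
    rintro _ ⟨Q, hQ, rfl⟩
    exact hmin' Q hQ
  have h2 : IsLeast {c | ∃ P ∈ U2 μx μy, ∃ Q ∈ U2 μx μy, c = cost Cx Cy p P Q}
      (cost Cx Cy p P P) := by
    refine ⟨⟨P, hP, P, hP, rfl⟩, ?_⟩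
    rintro _ ⟨P', hP', Q', hQ', rfl⟩
    exact hopt P' hP' Q' hQ'
  rw [GWval, COOTval, h1.csInf_eq, h2.csInf_eq]

end COOTGW
end

section
/- Suppose N = 2M and each tuple of the partition is a 2-tuple T_m = (2m−1, 2m), with a_{2m−1} = a_{2m} = n_m and μ_{2m−1} = μ_{2m} equal to the uniform distribution on [n_m], for every m = 1,…,M. Then F-MMOT((T_m)_{m=1}^M, μ) admits an optimal solution P = P_1 ⊗ … ⊗ P_M in which each component tensor satisfies P_m = (1/n_m)·σ_m for some permutation matrix σ_m ∈ {0,1}^{n_m×n_m}. -/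
open scoped BigOperators

namespace MMOTBirkhoff

/-- A coupling of two histograms `μ`, `ν` on `Fin k`: a nonnegative matrix with
row sums `μ` and column sums `ν`. -/
def IsCoupling {k : ℕ} (Q : Fin k → Fin k → ℝ) (μ ν : Fin k → ℝ) : Prop :=
  (∀ i j, 0 ≤ Q i j) ∧ (∀ i, ∑ j, Q i j = μ i) ∧ (∀ j, ∑ i, Q i j = ν j)

/-- A permutation matrix: a 0–1 square matrix with exactly one `1` in each row
and each column. -/
def IsPermMatrix {k : ℕ} (σ : Fin k → Fin k → ℝ) : Prop :=
  (∀ i j, σ i j = 0 ∨ σ i j = 1) ∧ (∀ i, ∑ j, σ i j = 1) ∧ (∀ j, ∑ i, σ i j = 1)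

/-- The tensor product `P_1 ⊗ … ⊗ P_M` of the component tensors `Q m`, each indexed
by the 2-tuple `T_m = (2m−1, 2m)` (the full index is grouped into consecutive pairs). -/
def tprodPair {M : ℕ} {n : Fin M → ℕ}
    (Q : (m : Fin M) → Fin (n m) → Fin (n m) → ℝ)
    (x : (m : Fin M) → Fin (n m) × Fin (n m)) : ℝ :=
  ∏ m, Q m (x m).1 (x m).2

/-- If `N = 2M`, each block of the partition is a 2-tuple
`T_m = (2m−1, 2m)` with `a_{2m−1} = a_{2m} = n_m` and both corresponding marginals
equal to the uniform distribution on `[n_m]`, then F-MMOT admits an optimal solution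
`P = P_1 ⊗ … ⊗ P_M` in which each component satisfies `P_m = (1/n_m)·σ_m` for some
permutation matrix `σ_m`. -/
theorem fmmot_has_permutation_solution {M : ℕ} (hM : 0 < M)
    (n : Fin M → ℕ) (hn : ∀ m, 0 < n m)
    (C : ((m : Fin M) → Fin (n m) × Fin (n m)) → ℝ) :
    ∃ Q : (m : Fin M) → Fin (n m) → Fin (n m) → ℝ,
      (∀ m, IsCoupling (Q m) (fun _ => 1 / (n m : ℝ)) (fun _ => 1 / (n m : ℝ))) ∧
      (∀ m, ∃ σ : Fin (n m) → Fin (n m) → ℝ, IsPermMatrix σ ∧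
        Q m = fun i j => (1 / (n m : ℝ)) * σ i j) ∧
      (∀ Q' : (m : Fin M) → Fin (n m) → Fin (n m) → ℝ,
        (∀ m, IsCoupling (Q' m) (fun _ => 1 / (n m : ℝ)) (fun _ => 1 / (n m : ℝ))) →
        ∑ x, C x * tprodPair Q x ≤ ∑ x, C x * tprodPair Q' x) := by
  classical
  let A : (m : Fin M) → Equiv.Perm (Fin (n m)) → Fin (n m) → Fin (n m) → ℝ :=
    fun m s i j => (1 / (n m : ℝ)) * s.permMatrix ℝ i j
  let F : ((m : Fin M) → Equiv.Perm (Fin (n m))) → ℝ :=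
    fun s => ∑ x, C x * tprodPair (fun m => A m (s m)) x
  obtain ⟨s, hs⟩ := Finite.exists_min F
  have hrow : ∀ m (t : Equiv.Perm (Fin (n m))) i, ∑ j, t.permMatrix ℝ i j = 1 := by
    intro m t i
    exact (mem_doublyStochastic_iff_sum.1 (permMatrix_mem_doublyStochastic (σ := t))).2.1 i
  have hcol : ∀ m (t : Equiv.Perm (Fin (n m))) j, ∑ i, t.permMatrix ℝ i j = 1 := by
    intro m t j
    exact (mem_doublyStochastic_iff_sum.1 (permMatrix_mem_doublyStochastic (σ := t))).2.2 j
  have hpos : ∀ m (t : Equiv.Perm (Fin (n m))) i j, 0 ≤ t.permMatrix ℝ i j := by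
    intro m t i j
    exact (mem_doublyStochastic_iff_sum.1 (permMatrix_mem_doublyStochastic (σ := t))).1 i j
  refine ⟨fun m => A m (s m), ?_, ?_, ?_⟩
  · intro m
    refine ⟨fun i j => mul_nonneg (by positivity) (hpos m _ i j), fun i => ?_, fun j => ?_⟩
    · simp only [A]
      rw [← Finset.mul_sum, hrow, mul_one]
    · simp only [A]
      rw [← Finset.mul_sum, hcol, mul_one]
  · intro m
    refine ⟨fun i j => (s m).permMatrix ℝ i j, ⟨fun i j => ?_, hrow m _, hcol m _⟩, rfl⟩
    simp only [Equiv.Perm.permMatrix, PEquiv.toMatrix_apply]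
    split_ifs <;> simp
  · intro Q' hQ'
    have hw : ∀ m, ∃ w : Equiv.Perm (Fin (n m)) → ℝ, (∀ t, 0 ≤ w t) ∧ ∑ t, w t = 1 ∧
        ∀ i j, Q' m i j = ∑ t, w t * A m t i j := by
      intro m
      have hnm : (n m : ℝ) ≠ 0 := by exact_mod_cast (hn m).ne'
      obtain ⟨h0, h1, h2⟩ := hQ' m
      have hmem : (Matrix.of fun i j => (n m : ℝ) * Q' m i j) ∈
          doublyStochastic ℝ (Fin (n m)) := by
        rw [mem_doublyStochastic_iff_sum]
        refine ⟨fun i j => mul_nonneg (by positivity) (h0 i j), fun i => ?_, fun j => ?_⟩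
        · simp only [Matrix.of_apply]
          rw [← Finset.mul_sum, h1]; field_simp
        · simp only [Matrix.of_apply]
          rw [← Finset.mul_sum, h2]; field_simp
      obtain ⟨w, hw0, hw1, hw2⟩ := exists_eq_sum_perm_of_mem_doublyStochastic hmem
      refine ⟨w, hw0, hw1, fun i j => ?_⟩
      have h := congrFun (congrFun hw2 i) j
      simp only [Matrix.sum_apply, Matrix.smul_apply, smul_eq_mul, Matrix.of_apply] at h
      have h3 : Q' m i j = (1 / (n m : ℝ)) * ((n m : ℝ) * Q' m i j) := by field_simp
      rw [h3, ← h, Finset.mul_sum]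
      refine Finset.sum_congr rfl fun t _ => ?_
      simp only [A]
      ring
    choose w hw0 hw1 hw2 using hw
    have hW : ∑ t : (m : Fin M) → Equiv.Perm (Fin (n m)), ∏ m, w m (t m) = 1 := by
      rw [← Fintype.prod_sum]
      simp [hw1]
    have hF : ∑ x, C x * tprodPair Q' x =
        ∑ t : (m : Fin M) → Equiv.Perm (Fin (n m)), (∏ m, w m (t m)) * F t := by
      simp only [F, Finset.mul_sum]
      rw [Finset.sum_comm]
      refine Finset.sum_congr rfl fun x _ => ?_
      simp only [tprodPair, hw2]
      rw [Fintype.prod_sum, Finset.mul_sum]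
      refine Finset.sum_congr rfl fun t _ => ?_
      rw [Finset.prod_mul_distrib]
      ring
    rw [hF]
    calc F s = ∑ t : (m : Fin M) → Equiv.Perm (Fin (n m)), (∏ m, w m (t m)) * F s := by
          rw [← Finset.sum_mul, hW, one_mul]
      _ ≤ _ := Finset.sum_le_sum fun t _ =>
          mul_le_mul_of_nonneg_left (hs t) (Finset.prod_nonneg fun m _ => hw0 m _)

end MMOTBirkhoff
end
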